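/- Let 1 < α < 2 and λ > 0, and define ψ(T₁,T₂;λ) = T₂ E_{α,1}(-λT₁^α) E_{α,2}(-λT₂^α) − T₁ E_{α,1}(-λT₂^α) E_{α,2}(-λT₁^α). Then there exists a constant M(λ) > 0 such that for all T₂ > T₁ ≥ M(λ), ψ(T₁,T₂;λ) ≤ (T₂−T₁)/(2Γ(1-α)Γ(2-α)) · 1/(λ²T₁^α T₂^α) < 0. -/

import Mathlib

/-- The real Mittag-Leffler function `E_{α,β}(x) = ∑_{k=0}^∞ x^k / Γ(kα + β)`. -/
noncomputable def mittagLefflerReal (α β x : ℝ) : ℝ :=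
  ∑' k : ℕ, x ^ k / Real.Gamma ((k : ℝ) * α + β)

/-- The determinant `ψ(T₁,T₂;λ)`. -/
noncomputable def psiDet (α T₁ T₂ lam : ℝ) : ℝ :=
  T₂ * mittagLefflerReal α 1 (-(lam * T₁ ^ α)) * mittagLefflerReal α 2 (-(lam * T₂ ^ α)) -
    T₁ * mittagLefflerReal α 1 (-(lam * T₂ ^ α)) * mittagLefflerReal α 2 (-(lam * T₁ ^ α))

section MittagLeffler

open MeasureTheory Filter Topology Complex

/-- On the critical line, `|Γ(1/2 + iy)|² = π / cosh(πy)`. -/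
theorem Complex.norm_Gamma_half_add_mul_I_sq (y : ℝ) :
    ‖Gamma (1 / 2 + y * I)‖ ^ 2 = Real.pi / Real.cosh (Real.pi * y) := by
  have h1 : (1 : ℂ) - (1 / 2 + y * I) = (starRingEnd ℂ) (1 / 2 + y * I) := by
    apply Complex.ext
    · simp; norm_num
    · simp
  have h := Gamma_mul_Gamma_one_sub (1 / 2 + y * I)
  have h2 : sin (Real.pi * (1 / 2 + y * I)) = (Real.cosh (Real.pi * y) : ℝ) := by
    rw [show (Real.pi : ℂ) * (1 / 2 + y * I) = (Real.pi * y : ℂ) * I + Real.pi / 2 by ring,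
      sin_add_pi_div_two, cos_mul_I]
    push_cast; rfl
  rw [h1, Gamma_conj, mul_conj, h2, normSq_eq_norm_sq] at h
  exact_mod_cast h

/-- The norm of a beta integral is at most the beta integral of the real parts. -/
theorem Complex.norm_betaIntegral_le (u v : ℂ) :
    ‖betaIntegral u v‖ ≤ (betaIntegral u.re v.re).re := by
  have hreal : betaIntegral u.re v.re =
      ((∫ x : ℝ in (0 : ℝ)..1, x ^ (u.re - 1) * (1 - x) ^ (v.re - 1) : ℝ) : ℂ) := by
    unfold betaIntegral
    rw [← intervalIntegral.integral_ofReal]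
    refine intervalIntegral.integral_congr fun x hx => ?_
    rw [Set.uIcc_of_le zero_le_one] at hx
    simp only [ofReal_mul]
    rw [ofReal_cpow hx.1, ofReal_cpow (sub_nonneg.2 hx.2)]
    push_cast; rfl
  rw [hreal, ofReal_re]
  unfold betaIntegral
  refine (intervalIntegral.norm_integral_le_integral_norm zero_le_one).trans (le_of_eq ?_)
  rw [intervalIntegral.integral_of_le zero_le_one, intervalIntegral.integral_of_le zero_le_one,
    integral_Ioc_eq_integral_Ioo, integral_Ioc_eq_integral_Ioo]
  refine setIntegral_congr_fun measurableSet_Ioo fun x hx => ?_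
  have h := norm_cpow_eq_rpow_re_of_pos (sub_pos.2 hx.2) (v - 1)
  push_cast at h
  simp only [norm_mul, norm_cpow_eq_rpow_re_of_pos hx.1, h]
  simp

/-- `1 / Γ` grows at most like `exp (π |Im w| / 2)` on vertical lines to the right of `1 / 2`. -/
theorem Complex.norm_inv_Gamma_le {w : ℂ} (hw : 1 / 2 < w.re) :
    ‖(Gamma w)⁻¹‖ ≤ Real.exp (Real.pi / 2 * |w.im|) / Real.Gamma w.re := by
  set y := w.im with hy
  set b : ℝ := w.re - 1 / 2 with hb
  have hb0 : 0 < b := by simp only [hb]; linarith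
  set u : ℂ := 1 / 2 + y * I with hu
  have hure : u.re = 1 / 2 := by simp [hu]
  have hw_eq : u + b = w := by
    apply Complex.ext
    · simp [hu, hb]
    · simp [hu, hy]
  have h1 := Gamma_mul_Gamma_eq_betaIntegral (s := u) (t := b) (by rw [hure]; norm_num)
    (by simpa using hb0)
  have h2 := Gamma_mul_Gamma_eq_betaIntegral (s := ((1 / 2 : ℝ) : ℂ)) (t := b)
    (by rw [ofReal_re]; norm_num) (by simpa using hb0)
  rw [hw_eq] at h1
  rw [show ((1 / 2 : ℝ) : ℂ) + b = (w.re : ℝ) by simp [hb], Gamma_ofReal, Gamma_ofReal,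
    Gamma_ofReal] at h2
  have h3 := norm_betaIntegral_le u b
  rw [hure, ofReal_re] at h3
  have hGw : 0 < Real.Gamma w.re := Real.Gamma_pos_of_pos (by linarith)
  have hGb : 0 < Real.Gamma b := Real.Gamma_pos_of_pos hb0
  have h2' : Real.Gamma (1 / 2) * Real.Gamma b =
      Real.Gamma w.re * (betaIntegral ((1 / 2 : ℝ) : ℂ) b).re := by
    have := congrArg re h2
    rwa [← ofReal_mul, ofReal_re, re_ofReal_mul] at this
  have hGw0 : 0 < ‖Gamma w‖ := norm_pos_iff.2 (Gamma_ne_zero_of_re_pos (by linarith))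
  have h1' : ‖Gamma u‖ * Real.Gamma b = ‖Gamma w‖ * ‖betaIntegral u b‖ := by
    have := congrArg norm h1
    rwa [norm_mul, norm_mul, Gamma_ofReal, norm_real, Real.norm_of_nonneg hGb.le] at this
  have hhalf : Real.Gamma (1 / 2) ≤ ‖Gamma u‖ * Real.exp (Real.pi / 2 * |y|) := by
    refine le_of_sq_le_sq ?_ (by positivity)
    rw [mul_pow, norm_Gamma_half_add_mul_I_sq, Real.Gamma_one_half_eq,
      Real.sq_sqrt Real.pi_pos.le, ← Real.exp_nat_mul, div_mul_eq_mul_div,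
      le_div_iff₀ (Real.cosh_pos _)]
    gcongr
    rw [show ((2 : ℕ) : ℝ) * (Real.pi / 2 * |y|) = |Real.pi * y| by
      rw [abs_mul, abs_of_pos Real.pi_pos]; push_cast; ring, ← Real.cosh_abs, Real.cosh_eq]
    have : Real.exp (-|Real.pi * y|) ≤ Real.exp |Real.pi * y| :=
      Real.exp_le_exp.2 (by linarith [abs_nonneg (Real.pi * y)])
    linarith
  rw [norm_inv, le_div_iff₀ hGw, inv_mul_le_iff₀ hGw0]
  have h4 : Real.Gamma w.re * (‖Gamma u‖ * Real.Gamma b) ≤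
      ‖Gamma w‖ * (Real.Gamma (1 / 2) * Real.Gamma b) := by
    rw [h1', h2']
    calc _ = ‖Gamma w‖ * (Real.Gamma w.re * ‖betaIntegral u b‖) := by ring
      _ ≤ _ := by gcongr
  have hGu0 : 0 < ‖Gamma u‖ := norm_pos_iff.2 (Gamma_ne_zero_of_re_pos (by rw [hure]; norm_num))
  have h5 : Real.Gamma w.re * ‖Gamma u‖ ≤ ‖Gamma w‖ * Real.Gamma (1 / 2) := by
    refine le_of_mul_le_mul_right ?_ hGb
    calc _ = _ := by ring
      _ ≤ _ := h4
      _ = _ := by ring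
  refine le_of_mul_le_mul_right ?_ hGu0
  calc _ ≤ ‖Gamma w‖ * Real.Gamma (1 / 2) := h5
    _ ≤ ‖Gamma w‖ * (‖Gamma u‖ * Real.exp (Real.pi / 2 * |y|)) := by gcongr
    _ = _ := by ring

/-- `1 / Γ` grows at most like `exp ((π / 2 + ε) |Im w|)` on the strip `-2 ≤ Re w ≤ X`. -/
theorem Complex.exists_norm_inv_Gamma_le {ε : ℝ} (hε : 0 < ε) (X : ℝ) :
    ∃ C, 0 < C ∧ ∀ w : ℂ, -2 ≤ w.re → w.re ≤ X →
      ‖(Gamma w)⁻¹‖ ≤ C * Real.exp ((Real.pi / 2 + ε) * |w.im|) := by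
  have hrec (w : ℂ) : (Gamma w)⁻¹ = w * (w + 1) * (w + 2) * (w + 3) * (Gamma (w + 4))⁻¹ := by
    rw [one_div_Gamma_eq_self_mul_one_div_Gamma_add_one w,
      one_div_Gamma_eq_self_mul_one_div_Gamma_add_one (w + 1),
      one_div_Gamma_eq_self_mul_one_div_Gamma_add_one (w + 1 + 1),
      one_div_Gamma_eq_self_mul_one_div_Gamma_add_one (w + 1 + 1 + 1)]
    ring_nf
  set a : ℝ := |X| + 5 with ha
  have ha0 : 0 < a := by positivity
  refine ⟨Nat.factorial 4 / ε ^ 4 * Real.exp (ε * a), by positivity, fun w h1 h2 => ?_⟩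
  have hG : ‖(Gamma (w + 4))⁻¹‖ ≤ Real.exp (Real.pi / 2 * |w.im|) := by
    have h := norm_inv_Gamma_le (w := w + 4) (by simp; linarith)
    have him : (w + 4).im = w.im := by simp
    rw [him] at h
    refine h.trans (div_le_self (Real.exp_pos _).le ?_)
    rw [← Real.Gamma_two]
    have h4 : 2 ≤ (w + 4).re := by simp; linarith
    exact Real.Gamma_strictMonoOn_Ici.monotoneOn (Set.self_mem_Ici) h4 h4
  have hn : ‖w‖ + 3 ≤ |w.im| + a := by
    have : |w.re| ≤ |X| + 2 := abs_le.2 ⟨by linarith [abs_nonneg X], by linarith [le_abs_self X]⟩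
    linarith [norm_le_abs_re_add_abs_im w]
  have hpoly : ‖w * (w + 1) * (w + 2) * (w + 3)‖ ≤ (|w.im| + a) ^ 4 := by
    have e1 : ‖w + 1‖ ≤ |w.im| + a := (norm_add_le _ _).trans (by simp; linarith)
    have e2 : ‖w + 2‖ ≤ |w.im| + a := (norm_add_le _ _).trans (by simp; linarith)
    have e3 : ‖w + 3‖ ≤ |w.im| + a := (norm_add_le _ _).trans (by simp; linarith)
    have e0 : ‖w‖ ≤ |w.im| + a := by linarith
    rw [norm_mul, norm_mul, norm_mul]
    calc _ ≤ (|w.im| + a) * (|w.im| + a) * (|w.im| + a) * (|w.im| + a) := by gcongr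
      _ = _ := by ring
  have hexp : (|w.im| + a) ^ 4 ≤ Nat.factorial 4 / ε ^ 4 * Real.exp (ε * (|w.im| + a)) := by
    have := Real.pow_div_factorial_le_exp (x := ε * (|w.im| + a)) (by positivity) 4
    rw [div_le_iff₀ (by positivity), mul_pow] at this
    rw [div_mul_eq_mul_div, le_div_iff₀ (by positivity)]
    linarith
  rw [hrec, norm_mul]
  calc _ ≤ (Nat.factorial 4 / ε ^ 4 * Real.exp (ε * (|w.im| + a))) *
        Real.exp (Real.pi / 2 * |w.im|) := by gcongr; exact hpoly.trans hexp
    _ = _ := by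
      rw [mul_assoc, ← Real.exp_add, mul_assoc, ← Real.exp_add]
      ring_nf

theorem Real.integrable_exp_mul_abs_div_cosh {κ : ℝ} (hκ : κ < Real.pi) :
    Integrable fun t : ℝ => Real.exp (κ * |t|) / Real.cosh (Real.pi * t) := by
  set c := Real.pi - κ with hc
  have hc0 : 0 < c := sub_pos.2 hκ
  set m := min 1 (c ^ 2 / 2) with hm
  have hm0 : 0 < m := by positivity
  refine (integrable_inv_one_add_sq.const_mul (2 / m)).mono' ?_ (Eventually.of_forall fun t => ?_)
  · refine Continuous.aestronglyMeasurable ?_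
    exact Continuous.div (by fun_prop) (by fun_prop) fun t => (Real.cosh_pos _).ne'
  · rw [Real.norm_of_nonneg (div_nonneg (Real.exp_pos _).le (Real.cosh_pos _).le),
      div_le_iff₀ (Real.cosh_pos _)]
    have h1 : Real.exp (Real.pi * |t|) / 2 ≤ Real.cosh (Real.pi * t) := by
      rw [← Real.cosh_abs, abs_mul, abs_of_pos Real.pi_pos, Real.cosh_eq]
      linarith [Real.exp_pos (-(Real.pi * |t|))]
    have h2 : m * (1 + t ^ 2) ≤ Real.exp (c * |t|) := by
      have := Real.quadratic_le_exp_of_nonneg (x := c * |t|) (by positivity)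
      have ha : m ≤ 1 := min_le_left _ _
      have hb : m * t ^ 2 ≤ c ^ 2 / 2 * t ^ 2 := by gcongr; exact min_le_right _ _
      have hd : 0 ≤ c * |t| := by positivity
      rw [mul_pow, sq_abs] at this
      linarith
    have h3 : 1 ≤ (m * (1 + t ^ 2))⁻¹ * Real.exp (c * |t|) := by
      rw [inv_mul_eq_div, one_le_div (by positivity)]
      exact h2
    calc Real.exp (κ * |t|) ≤ Real.exp (κ * |t|) * ((m * (1 + t ^ 2))⁻¹ * Real.exp (c * |t|)) :=
          le_mul_of_one_le_right (Real.exp_pos _).le h3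
      _ = 2 / m * (1 + t ^ 2)⁻¹ * (Real.exp (Real.pi * |t|) / 2) := by
          rw [show Real.pi * |t| = κ * |t| + c * |t| by rw [hc]; ring, Real.exp_add, mul_inv]
          ring
      _ ≤ _ := by gcongr

theorem integrable_div_cosh {g : ℝ → ℂ} (hg : Continuous g) {C κ : ℝ} (hκ : κ < Real.pi)
    (hb : ∀ t, ‖g t‖ ≤ C * Real.exp (κ * |t|)) :
    Integrable fun t : ℝ => g t / (Real.cosh (Real.pi * t) : ℝ) := by
  refine ((Real.integrable_exp_mul_abs_div_cosh hκ).const_mul C).mono' ?_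
    (Eventually.of_forall fun t => ?_)
  · refine Continuous.aestronglyMeasurable ?_
    exact Continuous.div hg (by fun_prop) fun t => ofReal_ne_zero.2 (Real.cosh_pos _).ne'
  · rw [norm_div, norm_real, Real.norm_of_nonneg (Real.cosh_pos _).le, ← mul_div_assoc]
    gcongr
    exact hb t

theorem norm_integral_div_cosh_le {g : ℝ → ℂ} {C κ : ℝ} (hκ : κ < Real.pi)
    (hb : ∀ t, ‖g t‖ ≤ C * Real.exp (κ * |t|)) :
    ‖∫ t : ℝ, g t / (Real.cosh (Real.pi * t) : ℝ)‖ ≤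
      C * ∫ t : ℝ, Real.exp (κ * |t|) / Real.cosh (Real.pi * t) := by
  rw [← integral_const_mul]
  refine norm_integral_le_of_norm_le ((Real.integrable_exp_mul_abs_div_cosh hκ).const_mul C)
    (Eventually.of_forall fun t => ?_)
  rw [norm_div, norm_real, Real.norm_of_nonneg (Real.cosh_pos _).le, ← mul_div_assoc]
  gcongr
  exact hb t

theorem integral_inv_cosh_pi_mul : ∫ t : ℝ, (Real.cosh (Real.pi * t))⁻¹ = 1 := by
  have hder (t : ℝ) : HasDerivAt (fun t => Real.arctan (Real.sinh (Real.pi * t)) / Real.pi)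
      (Real.cosh (Real.pi * t))⁻¹ t := by
    have h := ((((hasDerivAt_id t).const_mul Real.pi).sinh).arctan).div_const Real.pi
    refine h.congr_deriv ?_
    have hc := (Real.cosh_pos (Real.pi * t)).ne'
    have hp := Real.pi_ne_zero
    simp only [id]
    rw [← Real.cosh_sq', mul_one]
    field_simp
  have hint : Integrable fun t : ℝ => (Real.cosh (Real.pi * t))⁻¹ := by
    simpa using Real.integrable_exp_mul_abs_div_cosh Real.pi_pos
  have htop : Tendsto (fun t : ℝ => Real.sinh (Real.pi * t)) atTop atTop :=
    Real.sinhOrderIso.tendsto_atTop.comp (tendsto_id.const_mul_atTop Real.pi_pos)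
  have hbot : Tendsto (fun t : ℝ => Real.sinh (Real.pi * t)) atBot atBot :=
    Real.sinhOrderIso.tendsto_atBot.comp (tendsto_id.const_mul_atBot Real.pi_pos)
  rw [integral_of_hasDerivAt_of_tendsto hder hint
    ((((tendsto_nhds_of_tendsto_nhdsWithin Real.tendsto_arctan_atBot).comp hbot)).div_const _)
    ((((tendsto_nhds_of_tendsto_nhdsWithin Real.tendsto_arctan_atTop).comp htop)).div_const _)]
  have hp := Real.pi_ne_zero
  field_simp
  norm_num

theorem abs_sinh_le_norm_sin (s : ℂ) : |Real.sinh s.im| ≤ ‖sin s‖ := by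
  refine abs_le_of_sq_le_sq ?_ (norm_nonneg _)
  rw [← normSq_eq_norm_sq, sin_eq, normSq_apply]
  have h1 := Real.sin_sq_add_cos_sq s.re
  have h2 := Real.cosh_sq s.im
  have e1 : (sin s.re * cosh s.im + cos s.re * sinh s.im * I).re =
      Real.sin s.re * Real.cosh s.im := by
    simp [← ofReal_sin, ← ofReal_cos, ← ofReal_sinh, ← ofReal_cosh]
  have e2 : (sin s.re * cosh s.im + cos s.re * sinh s.im * I).im =
      Real.cos s.re * Real.sinh s.im := by
    simp [← ofReal_sin, ← ofReal_cos, ← ofReal_sinh, ← ofReal_cosh]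
  rw [e1, e2]
  nlinarith [sq_nonneg (Real.sin s.re)]

/-- Value at the centre of a strip as a `sech`-weighted average over the boundary lines. -/
theorem integral_strip_boundary {h : ℂ → ℂ} (hd : Differentiable ℂ h) {C κ : ℝ}
    (hκ : κ < Real.pi)
    (hb : ∀ s : ℂ, |s.re| ≤ 1 / 2 → ‖h s‖ ≤ C * Real.exp (κ * |s.im|)) :
    (∫ t : ℝ, h (1 / 2 + t * I) / (Real.cosh (Real.pi * t) : ℝ)) +
      (∫ t : ℝ, h (-1 / 2 + t * I) / (Real.cosh (Real.pi * t) : ℝ)) = 2 * h 0 := by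
  set S : ℂ → ℂ := fun s => sin (Real.pi * s) with hS
  have hSd : Differentiable ℂ S := by fun_prop
  set F : ℂ → ℂ := fun s => dslope h 0 s / dslope S 0 s with hF
  have hpi : (Real.pi : ℂ) ≠ 0 := ofReal_ne_zero.2 Real.pi_ne_zero
  have hS0 (s : ℂ) (hs : |s.re| ≤ 1 / 2) : dslope S 0 s ≠ 0 := by
    rcases eq_or_ne s 0 with rfl | hs0
    · rw [dslope_same]
      have : HasDerivAt S (cos (Real.pi * 0) * (Real.pi * 1)) 0 :=
        ((hasDerivAt_id (0 : ℂ)).const_mul (Real.pi : ℂ)).csin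
      rw [this.deriv]
      simp [hpi]
    · rw [dslope_of_ne _ hs0, slope_def_field]
      simp only [hS, mul_zero, sin_zero, sub_zero]
      refine div_ne_zero (fun h0 => hs0 ?_) hs0
      obtain ⟨k, hk⟩ := sin_eq_zero_iff.1 h0
      have hsk : s = k := by
        rw [mul_comm] at hk
        exact mul_right_cancel₀ hpi hk
      rw [hsk] at hs ⊢
      have : |(k : ℝ)| < 1 := lt_of_le_of_lt (by simpa using hs) (by norm_num : (1 / 2 : ℝ) < 1)
      have hk1 : |k| < 1 := by exact_mod_cast this
      simp [Int.abs_lt_one_iff.1 hk1]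
  have hdd {f : ℂ → ℂ} (hf : Differentiable ℂ f) : Differentiable ℂ (dslope f 0) := by
    rw [← differentiableOn_univ, differentiableOn_dslope univ_mem, differentiableOn_univ]
    exact hf
  have hFval (s : ℂ) (hs : s ≠ 0) : F s = (h s - h 0) / sin (Real.pi * s) := by
    simp only [hF, dslope_of_ne _ hs, slope_def_field, hS, mul_zero, sin_zero, sub_zero]
    rw [div_div_div_cancel_right₀ hs]
  have hneg (s : ℂ) : ∀ t : ℝ, s.re = 1 / 2 ∨ s.re = -1 / 2 → s + t * I ≠ 0 := by
    intro t ht h0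
    have := congrArg re h0
    simp at this
    rcases ht with ht | ht <;> rw [ht] at this <;> norm_num at this
  have hright (t : ℝ) : F (((1 / 2 : ℝ) : ℂ) + t * I) =
      (h (1 / 2 + t * I) - h 0) / (Real.cosh (Real.pi * t) : ℝ) := by
    rw [hFval _ (hneg _ t (Or.inl (ofReal_re _)))]
    congr 1
    · simp
    · rw [show (Real.pi : ℂ) * (((1 / 2 : ℝ) : ℂ) + t * I) =
        (Real.pi * t : ℂ) * I + Real.pi / 2 by push_cast; ring, sin_add_pi_div_two, cos_mul_I]
      push_cast; rfl
  have hleft (t : ℝ) : F (((-1 / 2 : ℝ) : ℂ) + t * I) =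
      -((h (-1 / 2 + t * I) - h 0) / (Real.cosh (Real.pi * t) : ℝ)) := by
    rw [hFval _ (hneg _ t (Or.inr (ofReal_re _))), ← div_neg]
    congr 1
    · simp
    · rw [show (Real.pi : ℂ) * (((-1 / 2 : ℝ) : ℂ) + t * I) =
        (Real.pi * t : ℂ) * I - Real.pi / 2 by push_cast; ring, sin_sub_pi_div_two, cos_mul_I]
      push_cast; rfl
  have hbr (t : ℝ) : ‖h (1 / 2 + t * I)‖ ≤ C * Real.exp (κ * |t|) := by
    simpa using hb (1 / 2 + t * I) (by simp)
  have hbl (t : ℝ) : ‖h (-1 / 2 + t * I)‖ ≤ C * Real.exp (κ * |t|) := by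
    simpa using hb (-1 / 2 + t * I) (by simp; norm_num)
  have hcr : Continuous fun t : ℝ => h (1 / 2 + t * I) := hd.continuous.comp (by fun_prop)
  have hcl : Continuous fun t : ℝ => h (-1 / 2 + t * I) := hd.continuous.comp (by fun_prop)
  have hir := integrable_div_cosh hcr hκ hbr
  have hil := integrable_div_cosh hcl hκ hbl
  have hi0 : Integrable fun t : ℝ => h 0 / (Real.cosh (Real.pi * t) : ℝ) :=
    integrable_div_cosh continuous_const Real.pi_pos (C := ‖h 0‖) (κ := 0) (by simp)
  have hrect (R : ℝ) (hR : 0 < R) :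
      (∫ x : ℝ in (-1 / 2 : ℝ)..(1 / 2), F (x + (-R : ℝ) * I)) -
        (∫ x : ℝ in (-1 / 2 : ℝ)..(1 / 2), F (x + R * I)) +
        I • (∫ y : ℝ in (-R)..R, F (((1 / 2 : ℝ) : ℂ) + y * I)) -
        I • (∫ y : ℝ in (-R)..R, F (((-1 / 2 : ℝ) : ℂ) + y * I)) = 0 := by
    have := integral_boundary_rect_eq_zero_of_differentiableOn F
      ⟨-1 / 2, -R⟩ ⟨1 / 2, R⟩ (fun s hs => by
        refine (((hdd hd) s).div ((hdd hSd) s) (hS0 s ?_)).differentiableWithinAt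
        have h1 := hs.1
        simp only [Set.mem_preimage] at h1
        rw [Set.uIcc_of_le (by norm_num)] at h1
        exact abs_le.2 ⟨by linarith [h1.1], h1.2⟩)
    exact this
  set B : ℝ → ℝ := fun R => (C * Real.exp (κ * R) + ‖h 0‖) / Real.sinh (Real.pi * R) with hB
  have hhor (R : ℝ) (hR : 0 < R) (r : ℝ) (hr : |r| = R) :
      ‖∫ x : ℝ in (-1 / 2 : ℝ)..(1 / 2), F (x + r * I)‖ ≤ B R := by
    have := intervalIntegral.norm_integral_le_of_norm_le_const (a := (-1 / 2 : ℝ)) (b := 1 / 2)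
      (f := fun x : ℝ => F (x + r * I)) (C := B R) (fun x hx => by
        rw [Set.uIoc_of_le (by norm_num)] at hx
        have hne : (x : ℂ) + r * I ≠ 0 := fun h0 => by
          have := congrArg im h0
          simp at this
          rw [this, abs_zero] at hr
          exact hR.ne hr
        have hsinh : Real.sinh (Real.pi * R) ≤ ‖sin (Real.pi * (x + r * I))‖ := by
          refine le_trans ?_ (abs_sinh_le_norm_sin _)
          have him : ((Real.pi : ℂ) * (x + r * I)).im = Real.pi * r := by simp
          rw [him, Real.abs_sinh, abs_mul, abs_of_pos Real.pi_pos, hr]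
        rw [hFval _ hne, norm_div]
        have hs0 : 0 < Real.sinh (Real.pi * R) := Real.sinh_pos_iff.2 (by positivity)
        have hbs := hb (x + r * I) (by
          simpa using abs_le.2 ⟨by linarith [hx.1], hx.2⟩)
        have him : ((x : ℂ) + r * I).im = r := by simp
        rw [him, hr] at hbs
        exact div_le_div₀ (add_nonneg ((norm_nonneg _).trans hbs) (norm_nonneg _))
          ((norm_sub_le _ _).trans (add_le_add_left hbs _)) hs0 hsinh)
    refine this.trans (le_of_eq ?_)
    norm_num
  have hBlim : Tendsto B atTop (𝓝 0) := by
    have hdecay {c : ℝ} (hc : 0 < c) : Tendsto (fun R => Real.exp (-(c * R))) atTop (𝓝 0) :=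
      Real.tendsto_exp_neg_atTop_nhds_zero.comp (tendsto_id.const_mul_atTop hc)
    have hmaj : Tendsto (fun R => 4 * (|C| * Real.exp (-((Real.pi - κ) * R)) +
        ‖h 0‖ * Real.exp (-(Real.pi * R)))) atTop (𝓝 0) := by
      simpa using (((hdecay (sub_pos.2 hκ)).const_mul |C|).add
        ((hdecay Real.pi_pos).const_mul ‖h 0‖)).const_mul 4
    refine squeeze_zero_norm' ?_ hmaj
    filter_upwards [eventually_ge_atTop 1] with R hR
    have hπR : 1 ≤ Real.pi * R := by nlinarith [Real.pi_gt_three]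
    have hsinh : Real.exp (Real.pi * R) / 4 ≤ Real.sinh (Real.pi * R) := by
      have h1 : Real.exp (-(Real.pi * R)) ≤ 1 := Real.exp_le_one_iff.2 (by linarith)
      have h2 := Real.add_one_le_exp (Real.pi * R)
      rw [Real.sinh_eq]
      linarith
    have hs0 : 0 < Real.sinh (Real.pi * R) := lt_of_lt_of_le (by positivity) hsinh
    have hnum : ‖C * Real.exp (κ * R) + ‖h 0‖‖ ≤ |C| * Real.exp (κ * R) + ‖h 0‖ := by
      refine (norm_add_le _ _).trans ?_
      rw [norm_mul, norm_norm, Real.norm_of_nonneg (Real.exp_pos _).le, Real.norm_eq_abs]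
    rw [norm_div, Real.norm_of_nonneg hs0.le]
    calc _ ≤ (|C| * Real.exp (κ * R) + ‖h 0‖) / (Real.exp (Real.pi * R) / 4) := by gcongr
      _ = _ := by
        rw [show -((Real.pi - κ) * R) = κ * R + -(Real.pi * R) by ring, Real.exp_add,
          Real.exp_neg]
        field_simp
  have hlim1 := intervalIntegral_tendsto_integral (hir.sub hi0) tendsto_neg_atTop_atBot
    (tendsto_id (α := ℝ))
  have hlim2 := intervalIntegral_tendsto_integral (hil.sub hi0) tendsto_neg_atTop_atBot
    (tendsto_id (α := ℝ))
  simp only [Pi.sub_apply] at hlim1 hlim2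
  have hsum := hlim1.add hlim2
  have hzero : Tendsto (fun R : ℝ =>
      (∫ t in (-R)..(id R), h (1 / 2 + t * I) / (Real.cosh (Real.pi * t) : ℝ) -
        h 0 / (Real.cosh (Real.pi * t) : ℝ)) +
      ∫ t in (-R)..(id R), h (-1 / 2 + t * I) / (Real.cosh (Real.pi * t) : ℝ) -
        h 0 / (Real.cosh (Real.pi * t) : ℝ)) atTop (𝓝 0) := by
    refine squeeze_zero_norm' (a := fun R => 2 * B R) ?_ (by simpa using hBlim.const_mul 2)
    filter_upwards [eventually_gt_atTop 0] with R hR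
    have h1 := hrect R hR
    simp only [hright, hleft, intervalIntegral.integral_neg, sub_div, smul_eq_mul] at h1
    rw [mul_neg, sub_neg_eq_add, add_assoc, ← mul_add] at h1
    have h2 := congrArg norm (eq_neg_of_add_eq_zero_right h1)
    rw [norm_mul, norm_I, one_mul, norm_neg] at h2
    rw [id, h2]
    refine (norm_sub_le _ _).trans ?_
    rw [two_mul]
    exact add_le_add (hhor R hR (-R) (by rw [abs_neg, abs_of_pos hR]))
      (hhor R hR R (abs_of_pos hR))
  have heq := tendsto_nhds_unique hsum hzero
  rw [integral_sub hir hi0, integral_sub hil hi0] at heq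
  have hconst : ∫ t : ℝ, h 0 / (Real.cosh (Real.pi * t) : ℝ) = h 0 := by
    simp only [div_eq_mul_inv, ← ofReal_inv]
    rw [integral_const_mul, integral_complex_ofReal, integral_inv_cosh_pi_mul]
    simp
  rw [hconst] at heq
  linear_combination heq

/-- The `sech`-weighted mean of `h` over the vertical line of abscissa `σ`. -/
noncomputable def sechLineMean (h : ℂ → ℂ) (σ : ℝ) : ℂ :=
  (∫ t : ℝ, h (σ + t * I) / (Real.cosh (Real.pi * t) : ℝ)) / 2

theorem sechLineMean_add_sechLineMean {h : ℂ → ℂ} (hd : Differentiable ℂ h) (c : ℝ) {C κ : ℝ}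
    (hκ : κ < Real.pi)
    (hb : ∀ s : ℂ, c - 1 / 2 ≤ s.re → s.re ≤ c + 1 / 2 → ‖h s‖ ≤ C * Real.exp (κ * |s.im|)) :
    sechLineMean h (c + 1 / 2) + sechLineMean h (c - 1 / 2) = h c := by
  have key := integral_strip_boundary (h := fun s => h (c + s)) (C := C) (κ := κ)
    (hd.comp (by fun_prop)) hκ (fun s hs => by
      have h1 := abs_le.1 hs
      simpa using hb (c + s) (by simp; linarith [h1.1]) (by simp; linarith [h1.2]))
  unfold sechLineMean
  rw [← add_div, div_eq_iff two_ne_zero, mul_comm (h c)]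
  simp only [add_zero] at key
  rw [← key]
  congr 1 <;> refine integral_congr_ae (Eventually.of_forall fun t => ?_) <;> simp only <;>
    congr 2 <;> push_cast <;> ring

/-- The Mellin transform density of `z ↦ E_{α,β}(-z)`, without its trigonometric factor. -/
noncomputable def mittagLefflerKernel (α β z : ℝ) (s : ℂ) : ℂ :=
  (z : ℂ) ^ (-s) * (Gamma (β - α * s))⁻¹

variable {α β z : ℝ}

theorem differentiable_mittagLefflerKernel (hz : 0 < z) :
    Differentiable ℂ (mittagLefflerKernel α β z) := by
  refine Differentiable.mul ?_ (differentiable_one_div_Gamma.comp (by fun_prop))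
  intro s
  exact (differentiableAt_id.neg).const_cpow (Or.inl (ofReal_ne_zero.2 hz.ne'))

theorem kernelExponent_lt_pi (hα2 : α < 2) : Real.pi * (α + 2) / 4 < Real.pi := by
  nlinarith [Real.pi_pos]

theorem exists_norm_inv_Gamma_sub_mul_le (hα1 : 1 < α) (hα2 : α < 2) (β a b : ℝ)
    (hb : -2 ≤ β - α * b) :
    ∃ C, 0 < C ∧ ∀ s : ℂ, a ≤ s.re → s.re ≤ b →
      ‖(Gamma (β - α * s))⁻¹‖ ≤ C * Real.exp (Real.pi * (α + 2) / 4 * |s.im|) := by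
  have hα0 : 0 < α := by linarith
  obtain ⟨C, hC, h⟩ := exists_norm_inv_Gamma_le (ε := Real.pi * (2 - α) / (4 * α))
    (div_pos (mul_pos Real.pi_pos (by linarith)) (by linarith)) (β - α * a)
  refine ⟨C, hC, fun s h1 h2 => ?_⟩
  have hre : ((β : ℂ) - α * s).re = β - α * s.re := by simp
  have him : ((β : ℂ) - α * s).im = -(α * s.im) := by simp
  have := h (β - α * s) (by rw [hre]; nlinarith) (by rw [hre]; nlinarith)
  rw [him, abs_neg, abs_mul, abs_of_pos hα0] at this
  refine this.trans (le_of_eq ?_)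
  congr 2
  field_simp
  ring

theorem exists_norm_mittagLefflerKernel_le (hα1 : 1 < α) (hα2 : α < 2) (hz : 0 < z) (a b : ℝ)
    (hb : -2 ≤ β - α * b) :
    ∃ C, ∀ s : ℂ, a ≤ s.re → s.re ≤ b →
      ‖mittagLefflerKernel α β z s‖ ≤ C * Real.exp (Real.pi * (α + 2) / 4 * |s.im|) := by
  obtain ⟨C, hC, h⟩ := exists_norm_inv_Gamma_sub_mul_le hα1 hα2 β a b hb
  refine ⟨Real.exp (|Real.log z| * (|a| + |b|)) * C, fun s h1 h2 => ?_⟩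
  rw [mittagLefflerKernel, norm_mul, norm_cpow_eq_rpow_re_of_pos hz, mul_assoc]
  gcongr
  · rw [Real.rpow_def_of_pos hz]
    refine Real.exp_le_exp.2 ((le_abs_self _).trans ?_)
    rw [abs_mul, neg_re, abs_neg]
    gcongr
    exact abs_le.2 ⟨by linarith [neg_abs_le a, abs_nonneg b],
      by linarith [le_abs_self b, abs_nonneg a]⟩
  · exact h s h1 h2

theorem mittagLefflerKernel_neg_natCast (k : ℕ) :
    mittagLefflerKernel α β z (-(k : ℂ)) = ((z ^ k / Real.Gamma (k * α + β) : ℝ) : ℂ) := by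
  rw [mittagLefflerKernel, neg_neg, cpow_natCast,
    show (β : ℂ) - α * -(k : ℂ) = ((k * α + β : ℝ) : ℂ) by push_cast; ring, Gamma_ofReal]
  push_cast
  rw [div_eq_mul_inv]

theorem summable_mittagLefflerReal (hα1 : 1 ≤ α) (hβ : 1 ≤ β) (x : ℝ) :
    Summable fun k : ℕ => x ^ k / Real.Gamma ((k : ℝ) * α + β) := by
  refine (Real.summable_pow_div_factorial |x|).of_norm_bounded_eventually_nat ?_
  filter_upwards [eventually_ge_atTop 1] with k hk
  have hk' : (1 : ℝ) ≤ k := by exact_mod_cast hk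
  have hle : (k : ℝ) + 1 ≤ k * α + β := by nlinarith
  have hΓ : (k.factorial : ℝ) ≤ Real.Gamma (k * α + β) := by
    rw [← Real.Gamma_nat_eq_factorial]
    exact Real.Gamma_strictMonoOn_Ici.monotoneOn (by simp only [Set.mem_Ici]; linarith)
      (by simp only [Set.mem_Ici]; linarith) hle
  have hf : (0 : ℝ) < k.factorial := by exact_mod_cast k.factorial_pos
  rw [norm_div, norm_pow, Real.norm_eq_abs, Real.norm_of_nonneg (hf.le.trans hΓ)]
  gcongr

theorem tendsto_sechLineMean_mittagLefflerKernel (hα1 : 1 < α) (hα2 : α < 2) (hβ : 1 ≤ β)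
    (hz : 0 < z) :
    Tendsto (fun n : ℕ => sechLineMean (mittagLefflerKernel α β z) (1 / 2 - n)) atTop (𝓝 0) := by
  have hα0 : 0 < α := by linarith
  set κ := Real.pi / 2 * α with hκ
  have hκπ : κ < Real.pi := by nlinarith [Real.pi_pos]
  set A := ∫ t : ℝ, Real.exp (κ * |t|) / Real.cosh (Real.pi * t) with hA
  have hA0 : 0 ≤ A := integral_nonneg fun t => div_nonneg (Real.exp_pos _).le (Real.cosh_pos _).le
  have hbound (n : ℕ) : ‖sechLineMean (mittagLefflerKernel α β z) (1 / 2 - (n + 2 : ℕ))‖ ≤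
      (z ^ (3 / 2 : ℝ) * A / 2) * (z ^ n / n.factorial) := by
    have hre (t : ℝ) : (((1 / 2 - (n + 2 : ℕ) : ℝ) : ℂ) + t * I).re = 1 / 2 - (n + 2 : ℕ) := by
      simp
    have him (t : ℝ) : (((1 / 2 - (n + 2 : ℕ) : ℝ) : ℂ) + t * I).im = t := by simp
    have hn0 : (0 : ℝ) ≤ n := n.cast_nonneg
    have hf : (0 : ℝ) < n.factorial := by exact_mod_cast n.factorial_pos
    have hb (t : ℝ) : ‖mittagLefflerKernel α β z (((1 / 2 - (n + 2 : ℕ) : ℝ) : ℂ) + t * I)‖ ≤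
        (z ^ (3 / 2 : ℝ) * z ^ n / n.factorial) * Real.exp (κ * |t|) := by
      set s := ((1 / 2 - (n + 2 : ℕ) : ℝ) : ℂ) + t * I with hs
      have hwre : ((β : ℂ) - α * s).re = β + α * (n + 3 / 2) := by
        rw [sub_re, re_ofReal_mul, ofReal_re, hs, hre]; push_cast; ring
      have hwim : ((β : ℂ) - α * s).im = -(α * t) := by
        rw [sub_im, im_ofReal_mul, ofReal_im, hs, him, zero_sub]
      have hge : (n : ℝ) + 2 ≤ β + α * (n + 3 / 2) := by nlinarith
      have hG := norm_inv_Gamma_le (w := β - α * s) (by rw [hwre]; linarith)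
      rw [hwre, hwim, abs_neg, abs_mul, abs_of_pos hα0, ← mul_assoc] at hG
      have hΓ : (n.factorial : ℝ) ≤ Real.Gamma (β + α * (n + 3 / 2)) := by
        calc (n.factorial : ℝ) ≤ (n + 1).factorial := by
              exact_mod_cast Nat.factorial_le (Nat.le_succ n)
          _ = Real.Gamma (n + 2) := by
              rw [← Real.Gamma_nat_eq_factorial]; push_cast; ring_nf
          _ ≤ _ := Real.Gamma_strictMonoOn_Ici.monotoneOn (by simp only [Set.mem_Ici]; linarith)
              (by simp only [Set.mem_Ici]; linarith) hge
      rw [mittagLefflerKernel, norm_mul, norm_cpow_eq_rpow_re_of_pos hz, neg_re, hre,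
        show -(1 / 2 - ((n + 2 : ℕ) : ℝ)) = 3 / 2 + n by push_cast; ring,
        Real.rpow_add_natCast hz.ne']
      calc _ ≤ z ^ (3 / 2 : ℝ) * z ^ n * (Real.exp (κ * |t|) / n.factorial) := by
            gcongr
            exact hG.trans (by gcongr)
        _ = _ := by ring
    have := norm_integral_div_cosh_le hκπ hb
    rw [sechLineMean, norm_div]
    simp only [RCLike.norm_ofNat]
    calc _ ≤ (z ^ (3 / 2 : ℝ) * z ^ n / n.factorial * A) / 2 := by gcongr
      _ = _ := by ring
  rw [← tendsto_add_atTop_iff_nat 2]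
  refine squeeze_zero_norm hbound ?_
  simpa using (FloorSemiring.tendsto_pow_div_factorial_atTop z).const_mul
    (z ^ (3 / 2 : ℝ) * A / 2)

/-- Mellin–Barnes representation of `E_{α,β}(-z)`. -/
theorem mittagLefflerReal_neg_eq_sechLineMean (hα1 : 1 < α) (hα2 : α < 2) (hβ : 1 ≤ β)
    (hz : 0 < z) :
    (mittagLefflerReal α β (-z) : ℂ) = sechLineMean (mittagLefflerKernel α β z) (1 / 2) := by
  set P : ℕ → ℂ := fun n => sechLineMean (mittagLefflerKernel α β z) (1 / 2 - n) with hP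
  have hstep (k : ℕ) : P k + P (k + 1) = mittagLefflerKernel α β z (-(k : ℂ)) := by
    have hk0 : (0 : ℝ) ≤ k := k.cast_nonneg
    obtain ⟨C, hC⟩ := exists_norm_mittagLefflerKernel_le (β := β) hα1 hα2 hz (-k - 1 / 2)
      (-k + 1 / 2) (by nlinarith)
    have := sechLineMean_add_sechLineMean (differentiable_mittagLefflerKernel (α := α) (β := β) hz)
      (-(k : ℝ)) (kernelExponent_lt_pi hα2) hC
    simp only [hP]
    rw [← ofReal_natCast, ← ofReal_neg, ← this]
    congr 2
    · ring
    · push_cast; ring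
  have hpart (n : ℕ) : ∑ k ∈ Finset.range n,
      (((-z) ^ k / Real.Gamma ((k : ℝ) * α + β) : ℝ) : ℂ) = P 0 - (-1) ^ n * P n := by
    induction n with
    | zero => simp
    | succ n ih =>
      have h := hstep n
      rw [mittagLefflerKernel_neg_natCast] at h
      rw [Finset.sum_range_succ, ih, neg_pow z, mul_div_assoc, ofReal_mul, ← h]
      push_cast
      ring
  have hlim := tendsto_sechLineMean_mittagLefflerKernel hα1 hα2 hβ hz
  have hlim' : Tendsto (fun n : ℕ => P 0 - (-1) ^ n * P n) atTop (𝓝 (P 0)) := by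
    have : Tendsto (fun n : ℕ => (-1 : ℂ) ^ n * P n) atTop (𝓝 0) := by
      rw [tendsto_zero_iff_norm_tendsto_zero] at hlim ⊢
      simpa [hP] using hlim
    simpa using tendsto_const_nhds.sub this
  have hsum := ((summable_mittagLefflerReal hα1.le hβ (-z)).hasSum.mapL ofRealCLM).tendsto_sum_nat
  have hP0 : P 0 = sechLineMean (mittagLefflerKernel α β z) (1 / 2) := by simp [hP]
  rw [← hP0]
  refine tendsto_nhds_unique ?_ hlim'
  refine Tendsto.congr hpart ?_
  exact hsum

theorem mul_mittagLefflerReal_neg_eq (hα1 : 1 < α) (hα2 : α < 2) (hβ : 1 ≤ β) (hz : 0 < z) :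
    ((z * mittagLefflerReal α β (-z) - (Real.Gamma (β - α))⁻¹ : ℝ) : ℂ) =
      -(∫ t : ℝ, (exp (-(1 / 2 + t * I) * Real.log z) * (Gamma (β - α * (3 / 2 + t * I)))⁻¹) /
        (Real.cosh (Real.pi * t) : ℝ)) / 2 := by
  obtain ⟨C, hC⟩ := exists_norm_mittagLefflerKernel_le (β := β) hα1 hα2 hz (1 - 1 / 2)
      (1 + 1 / 2) (by nlinarith)
  have h := sechLineMean_add_sechLineMean (differentiable_mittagLefflerKernel (α := α) (β := β) hz)
      1 (kernelExponent_lt_pi hα2) hC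
  have hz0 : (z : ℂ) ≠ 0 := ofReal_ne_zero.2 hz.ne'
  rw [show (1 : ℝ) - 1 / 2 = 1 / 2 by norm_num,
    ← mittagLefflerReal_neg_eq_sechLineMean hα1 hα2 hβ hz] at h
  have h1 : mittagLefflerKernel α β z ((1 : ℝ) : ℂ) = (z : ℂ)⁻¹ * ((Real.Gamma (β - α))⁻¹ : ℝ) := by
    rw [mittagLefflerKernel, ofReal_one, cpow_neg_one, mul_one, ← ofReal_sub, Gamma_ofReal,
      ofReal_inv]
  have h2 : sechLineMean (mittagLefflerKernel α β z) (1 + 1 / 2) = (z : ℂ)⁻¹ *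
      ((∫ t : ℝ, (exp (-(1 / 2 + t * I) * Real.log z) * (Gamma (β - α * (3 / 2 + t * I)))⁻¹) /
        (Real.cosh (Real.pi * t) : ℝ)) / 2) := by
    rw [sechLineMean, ← mul_div_assoc, ← integral_const_mul]
    congr 1
    refine integral_congr_ae (Eventually.of_forall fun t => ?_)
    simp only [mittagLefflerKernel]
    rw [show ((1 + 1 / 2 : ℝ) : ℂ) + t * I = 3 / 2 + t * I by push_cast; ring,
      show -(3 / 2 + t * I) = -1 + -(1 / 2 + t * I) by ring, cpow_add _ _ hz0, cpow_neg_one,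
      cpow_def_of_ne_zero hz0 (-(1 / 2 + t * I)), ← ofReal_log hz.le, mul_comm (Real.log z : ℂ)]
    ring
  rw [h1, h2] at h
  generalize (∫ t : ℝ, (exp (-(1 / 2 + t * I) * Real.log z) *
    (Gamma (β - α * (3 / 2 + t * I)))⁻¹) / (Real.cosh (Real.pi * t) : ℝ)) = J at h ⊢
  push_cast at h ⊢
  have h3 := congrArg (fun w => (z : ℂ) * w) h
  simp only [mul_add, mul_inv_cancel_left₀ hz0] at h3
  linear_combination h3

theorem norm_exp_neg_mul_sub_le {w : ℂ} (hw : 0 ≤ w.re) {x y : ℝ} (hxy : x ≤ y) :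
    ‖exp (-w * y) - exp (-w * x)‖ ≤ ‖w‖ * Real.exp (-w.re * x) * (y - x) := by
  refine norm_image_sub_le_of_norm_deriv_le_segment' (f := fun u : ℝ => exp (-w * u))
    (f' := fun u : ℝ => exp (-w * u) * (-w * 1)) (a := x) (b := y) (fun u _ => ?_)
    (fun u hu => ?_) y (Set.right_mem_Icc.2 hxy)
  · exact (((hasDerivAt_id u).ofReal_comp).const_mul (-w)).cexp.hasDerivWithinAt
  · rw [norm_mul, norm_exp, mul_one, norm_neg, mul_comm]
    have : (-w * (u : ℂ)).re = -w.re * u := by simp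
    rw [this]
    gcongr ‖w‖ * Real.exp ?_
    nlinarith [hu.1]

/-- Leading asymptotics of `z E_{α,β}(-z)` as `z → ∞`, with a matching modulus of continuity
in the variable `log z`. -/
theorem exists_mul_mittagLefflerReal_neg_bounds (hα1 : 1 < α) (hα2 : α < 2) (hβ : 1 ≤ β) :
    ∃ C, 0 < C ∧ (∀ z, 0 < z →
        |z * mittagLefflerReal α β (-z) - (Real.Gamma (β - α))⁻¹| ≤
          C * Real.exp (-(1 / 2) * Real.log z)) ∧
      ∀ z₁ z₂, 0 < z₁ → z₁ ≤ z₂ →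
        |z₂ * mittagLefflerReal α β (-z₂) - z₁ * mittagLefflerReal α β (-z₁)| ≤
          C * Real.exp (-(1 / 2) * Real.log z₁) * (Real.log z₂ - Real.log z₁) := by
  obtain ⟨D, hD, hΓ⟩ := exists_norm_inv_Gamma_sub_mul_le hα1 hα2 β (3 / 2) (3 / 2) (by linarith)
  set κ := Real.pi * (α + 2) / 4 with hκ
  have hκπ : κ < Real.pi := kernelExponent_lt_pi hα2
  set κ' := (κ + Real.pi) / 2 with hκ'
  have hκπ' : κ' < Real.pi := by linarith
  set δ := κ' - κ with hδ
  have hδ0 : 0 < δ := by linarith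
  set g : ℝ → ℂ := fun t => (Gamma (β - α * (3 / 2 + t * I)))⁻¹ with hg
  have hgc : Continuous g := differentiable_one_div_Gamma.continuous.comp (by fun_prop)
  have hgb (t : ℝ) : ‖g t‖ ≤ D * Real.exp (κ * |t|) := by
    simpa [hg] using hΓ (3 / 2 + t * I) (by simp) (by simp)
  have hwre (t : ℝ) : ((1 : ℂ) / 2 + t * I).re = 1 / 2 := by simp
  have hw (t : ℝ) : ‖(1 : ℂ) / 2 + t * I‖ ≤ (1 + 1 / δ) * Real.exp (δ * |t|) := by
    have h1 : ‖(1 : ℂ) / 2 + t * I‖ ≤ 1 + |t| := by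
      refine (norm_add_le _ _).trans ?_
      simp
      norm_num
    have h2 := Real.add_one_le_exp (δ * |t|)
    have h3 : 1 ≤ Real.exp (δ * |t|) := Real.one_le_exp (by positivity)
    have h4 : |t| ≤ 1 / δ * Real.exp (δ * |t|) := by
      rw [div_mul_eq_mul_div, le_div_iff₀ hδ0]
      linarith
    linarith
  have hebound (x t : ℝ) : ‖exp (-(1 / 2 + t * I) * x) * g t‖ ≤
      D * Real.exp (-(1 / 2) * x) * Real.exp (κ * |t|) := by
    rw [norm_mul, norm_exp]
    have : (-(1 / 2 + (t : ℂ) * I) * x).re = -(1 / 2) * x := by simp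
    rw [this]
    calc _ ≤ Real.exp (-(1 / 2) * x) * (D * Real.exp (κ * |t|)) := by gcongr; exact hgb t
      _ = _ := by ring
  have hdiff {x y : ℝ} (hxy : x ≤ y) (t : ℝ) :
      ‖exp (-(1 / 2 + t * I) * y) * g t - exp (-(1 / 2 + t * I) * x) * g t‖ ≤
        (D * (1 + 1 / δ) * Real.exp (-(1 / 2) * x) * (y - x)) * Real.exp (κ' * |t|) := by
    rw [← sub_mul, norm_mul]
    have h := norm_exp_neg_mul_sub_le (w := 1 / 2 + t * I) (by rw [hwre]; norm_num) hxy
    rw [hwre] at h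
    have hyx := sub_nonneg.2 hxy
    calc _ ≤ ((1 + 1 / δ) * Real.exp (δ * |t|) * Real.exp (-(1 / 2) * x) * (y - x)) *
          (D * Real.exp (κ * |t|)) := by
            gcongr
            · exact h.trans (by gcongr; exact hw t)
            · exact hgb t
      _ = _ := by
        rw [show κ' * |t| = κ * |t| + δ * |t| by rw [hδ]; ring, Real.exp_add]
        ring
  set A := ∫ t : ℝ, Real.exp (κ * |t|) / Real.cosh (Real.pi * t) with hA
  set A' := ∫ t : ℝ, Real.exp (κ' * |t|) / Real.cosh (Real.pi * t) with hA'
  have hA0 : 0 ≤ A := integral_nonneg fun t => div_nonneg (Real.exp_pos _).le (Real.cosh_pos _).le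
  have hA0' : 0 ≤ A' :=
    integral_nonneg fun t => div_nonneg (Real.exp_pos _).le (Real.cosh_pos _).le
  refine ⟨D * A + D * (1 + 1 / δ) * A' + 1, by positivity, fun z hz => ?_,
    fun z₁ z₂ hz₁ hz => ?_⟩
  · rw [← Real.norm_eq_abs, ← norm_real, mul_mittagLefflerReal_neg_eq hα1 hα2 hβ hz, norm_div,
      norm_neg]
    have h := norm_integral_div_cosh_le hκπ (hebound (Real.log z))
    have hE := Real.exp_pos (-(1 / 2) * Real.log z)
    have h0 := (norm_nonneg _).trans h
    have h5 : 0 ≤ D * (1 + 1 / δ) * A' * Real.exp (-(1 / 2) * Real.log z) := by positivity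
    rw [RCLike.norm_ofNat]
    linarith
  · have hz₂ := hz₁.trans_le hz
    have hlog := Real.log_le_log hz₁ hz
    have hint (x : ℝ) := integrable_div_cosh
      (g := fun t => exp (-(1 / 2 + t * I) * x) * g t) (by fun_prop) hκπ (hebound x)
    have heq : ((z₂ * mittagLefflerReal α β (-z₂) - z₁ * mittagLefflerReal α β (-z₁) : ℝ) : ℂ) =
        -(∫ t : ℝ, (exp (-(1 / 2 + t * I) * Real.log z₂) * g t -
          exp (-(1 / 2 + t * I) * Real.log z₁) * g t) / (Real.cosh (Real.pi * t) : ℝ)) / 2 := by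
      simp only [sub_div]
      rw [integral_sub (hint _) (hint _)]
      have e1 := mul_mittagLefflerReal_neg_eq hα1 hα2 hβ hz₁
      have e2 := mul_mittagLefflerReal_neg_eq hα1 hα2 hβ hz₂
      rw [ofReal_sub] at e1 e2 ⊢
      linear_combination e2 - e1
    rw [← Real.norm_eq_abs, ← norm_real, heq, norm_div, norm_neg]
    have h := norm_integral_div_cosh_le hκπ' (hdiff hlog)
    have h0 := (norm_nonneg _).trans h
    have h5 : 0 ≤ (D * A + 1) * Real.exp (-(1 / 2) * Real.log z₁) *
        (Real.log z₂ - Real.log z₁) :=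
      mul_nonneg (by positivity) (sub_nonneg.2 hlog)
    rw [RCLike.norm_ofNat]
    linarith

/-- A `2 × 2` determinant with entries close to those of a rank-one limit is dominated by its
leading term. -/
theorem mul_sub_mul_le_of_near {T₁ T₂ g₁ g₂ δ a₁ a₂ b₁ b₂ : ℝ} (hT₁ : 0 < T₁) (hT : T₁ < T₂)
    (hδ1 : δ ≤ 1) (hδ : 10 * δ * (|g₁| + |g₂| + 1) ≤ -(g₁ * g₂))
    (ha₁ : |a₁ - g₁| ≤ δ) (hb₁ : |b₁ - g₂| ≤ δ) (hb₂ : |b₂ - g₂| ≤ δ)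
    (ha : |a₂ - a₁| ≤ δ * (2 * ((T₂ - T₁) / T₁))) (hb : |b₂ - b₁| ≤ δ * (2 * ((T₂ - T₁) / T₁))) :
    T₂ * a₁ * b₂ - T₁ * a₂ * b₁ ≤ (T₂ - T₁) * (g₁ * g₂) / 2 := by
  have hd : 0 < T₂ - T₁ := sub_pos.2 hT
  have hδ0 : 0 ≤ δ := (abs_nonneg _).trans ha₁
  have hT₁' (u : ℝ) (hu : |u| ≤ δ * (2 * ((T₂ - T₁) / T₁))) : |T₁ * u| ≤ 2 * δ * (T₂ - T₁) := by
    rw [abs_mul, abs_of_pos hT₁]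
    calc _ ≤ T₁ * (δ * (2 * ((T₂ - T₁) / T₁))) := by gcongr
      _ = _ := by field_simp
  have hA : |a₁| ≤ |g₁| + 1 := by
    have := abs_add_le (a₁ - g₁) g₁
    rw [sub_add_cancel] at this
    linarith
  have hB : |b₁| ≤ |g₂| + 1 := by
    have := abs_add_le (b₁ - g₂) g₂
    rw [sub_add_cancel] at this
    linarith
  have h1 : a₁ * b₂ - g₁ * g₂ ≤ δ * (|g₁| + |g₂| + 1) := by
    calc a₁ * b₂ - g₁ * g₂ = a₁ * (b₂ - g₂) + (a₁ - g₁) * g₂ := by ring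
      _ ≤ |a₁ * (b₂ - g₂)| + |(a₁ - g₁) * g₂| := add_le_add (le_abs_self _) (le_abs_self _)
      _ ≤ (|g₁| + 1) * δ + δ * |g₂| := by rw [abs_mul, abs_mul]; gcongr
      _ = _ := by ring
  have h2 : a₁ * (T₁ * (b₂ - b₁)) ≤ (|g₁| + 1) * (2 * δ * (T₂ - T₁)) := by
    refine (le_abs_self _).trans ?_
    rw [abs_mul]
    gcongr
    exact hT₁' _ hb
  have h3 : -(b₁ * (T₁ * (a₂ - a₁))) ≤ (|g₂| + 1) * (2 * δ * (T₂ - T₁)) := by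
    refine (neg_le_abs _).trans ?_
    rw [abs_mul]
    gcongr
    exact hT₁' _ ha
  have h4 := mul_le_mul_of_nonneg_left h1 hd.le
  have h5 := mul_le_mul_of_nonneg_left hδ hd.le
  have h6 : 0 ≤ δ * (T₂ - T₁) := by positivity
  have h7 : 0 ≤ δ * (T₂ - T₁) * |g₁| := by positivity
  have h8 : 0 ≤ δ * (T₂ - T₁) * |g₂| := by positivity
  linear_combination h4 + h2 + h3 + h5 / 2 + 2 * h7 + 2 * h8

end MittagLeffler

/-- Lemma 3.3: for `1 < α < 2` and `λ > 0` there is `M(λ) > 0` such that for all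
`T₂ > T₁ ≥ M(λ)`,
`ψ(T₁,T₂;λ) ≤ (T₂−T₁)/(2Γ(1-α)Γ(2-α)) · 1/(λ²T₁^α T₂^α) < 0`. -/
theorem psiDet_neg_for_large_times (α lam : ℝ) (hα1 : 1 < α) (hα2 : α < 2) (hlam : 0 < lam) :
    ∃ M : ℝ, 0 < M ∧ ∀ T₁ T₂ : ℝ, M ≤ T₁ → T₁ < T₂ →
      psiDet α T₁ T₂ lam ≤
        (T₂ - T₁) / (2 * Real.Gamma (1 - α) * Real.Gamma (2 - α)) *
          (1 / (lam ^ 2 * T₁ ^ α * T₂ ^ α)) ∧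
      (T₂ - T₁) / (2 * Real.Gamma (1 - α) * Real.Gamma (2 - α)) *
          (1 / (lam ^ 2 * T₁ ^ α * T₂ ^ α)) < 0 := by
  have hα0 : 0 < α := by linarith
  have hG2 : 0 < Real.Gamma (2 - α) := Real.Gamma_pos_of_pos (by linarith)
  have hG1 : Real.Gamma (1 - α) < 0 := by
    have h := Real.Gamma_add_one (s := 1 - α) (by linarith)
    rw [show 1 - α + 1 = 2 - α by ring] at h
    exact neg_of_mul_pos_right (h ▸ hG2) (by linarith)
  obtain ⟨C₁, hC₁, hlim₁, hcont₁⟩ := exists_mul_mittagLefflerReal_neg_bounds hα1 hα2 le_rfl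
  obtain ⟨C₂, hC₂, hlim₂, hcont₂⟩ := exists_mul_mittagLefflerReal_neg_bounds (β := 2) hα1 hα2
    one_le_two
  set g₁ := (Real.Gamma (1 - α))⁻¹ with hg₁
  set g₂ := (Real.Gamma (2 - α))⁻¹ with hg₂
  have hgg : g₁ * g₂ < 0 := mul_neg_of_neg_of_pos (inv_lt_zero.2 hG1) (inv_pos.2 hG2)
  set K := 10 * (|g₁| + |g₂| + 1) with hK
  have hK0 : 0 < K := by positivity
  set δ := min 1 (-(g₁ * g₂) / K) with hδ
  have hδ0 : 0 < δ := lt_min one_pos (div_pos (neg_pos.2 hgg) hK0)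
  have hδK : 10 * δ * (|g₁| + |g₂| + 1) ≤ -(g₁ * g₂) := by
    have := (le_div_iff₀ hK0).1 (min_le_right 1 (-(g₁ * g₂) / K))
    rw [hK] at this
    linarith
  have hlog (T : ℝ) (hT : 0 < T) : Real.log (lam * T ^ α) = Real.log lam + α * Real.log T := by
    rw [Real.log_mul hlam.ne' (Real.rpow_pos_of_pos hT α).ne', Real.log_rpow hT]
  have hsmall : ∀ᶠ T : ℝ in Filter.atTop,
      (C₁ + C₂) * Real.exp (-(1 / 2) * (Real.log lam + α * Real.log T)) < δ := by
    have h1 : Filter.Tendsto (fun T : ℝ => Real.log lam + α * Real.log T) Filter.atTop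
        Filter.atTop :=
      Filter.tendsto_atTop_add_const_left _ _ (Real.tendsto_log_atTop.const_mul_atTop hα0)
    have h2 := (Real.tendsto_exp_atBot.comp
      (h1.const_mul_atTop_of_neg (by norm_num : (-(1 / 2) : ℝ) < 0))).const_mul (C₁ + C₂)
    rw [mul_zero] at h2
    exact h2.eventually_lt_const hδ0
  obtain ⟨M, hM⟩ := Filter.eventually_atTop.1 hsmall
  refine ⟨max M 1, by positivity, fun T₁ T₂ hMT hT => ?_⟩
  have hT₁ : 0 < T₁ := by linarith [le_max_right M 1]
  have hT₂ : 0 < T₂ := hT₁.trans hT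
  have hp₁ : 0 < T₁ ^ α := Real.rpow_pos_of_pos hT₁ α
  have hp₂ : 0 < T₂ ^ α := Real.rpow_pos_of_pos hT₂ α
  have hz₁ : 0 < lam * T₁ ^ α := by positivity
  have hz₂ : 0 < lam * T₂ ^ α := by positivity
  have hzz : lam * T₁ ^ α ≤ lam * T₂ ^ α := by gcongr
  have hexp (T : ℝ) (hT0 : 0 < T) (hT : M ≤ T) :
      C₁ * Real.exp (-(1 / 2) * Real.log (lam * T ^ α)) ≤ δ ∧
        C₂ * Real.exp (-(1 / 2) * Real.log (lam * T ^ α)) ≤ δ := by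
    have h := hM T hT
    rw [← hlog T hT0] at h
    have hE := Real.exp_pos (-(1 / 2) * Real.log (lam * T ^ α))
    constructor <;> nlinarith
  have hM₁ : M ≤ T₁ := (le_max_left _ _).trans hMT
  obtain ⟨hs₁, hs₁'⟩ := hexp T₁ hT₁ hM₁
  obtain ⟨-, hs₂⟩ := hexp T₂ hT₂ (hM₁.trans hT.le)
  have hlogdiff : Real.log (lam * T₂ ^ α) - Real.log (lam * T₁ ^ α) ≤ 2 * ((T₂ - T₁) / T₁) := by
    rw [hlog T₁ hT₁, hlog T₂ hT₂]
    have h1 : Real.log T₂ - Real.log T₁ ≤ (T₂ - T₁) / T₁ := by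
      rw [← Real.log_div hT₂.ne' hT₁.ne', sub_div, div_self hT₁.ne']
      exact Real.log_le_sub_one_of_pos (by positivity)
    have h2 : 0 ≤ Real.log T₂ - Real.log T₁ := sub_nonneg.2 (Real.log_le_log hT₁ hT.le)
    nlinarith
  have hlog0 : 0 ≤ Real.log (lam * T₂ ^ α) - Real.log (lam * T₁ ^ α) :=
    sub_nonneg.2 (Real.log_le_log hz₁ hzz)
  have key := mul_sub_mul_le_of_near hT₁ hT (min_le_left _ _) hδK
    ((hlim₁ _ hz₁).trans hs₁) ((hlim₂ _ hz₁).trans hs₁') ((hlim₂ _ hz₂).trans hs₂)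
    ((hcont₁ _ _ hz₁ hzz).trans (mul_le_mul hs₁ hlogdiff hlog0 hδ0.le))
    ((hcont₂ _ _ hz₁ hzz).trans (mul_le_mul hs₁' hlogdiff hlog0 hδ0.le))
  have hZ : 0 < lam ^ 2 * T₁ ^ α * T₂ ^ α := by positivity
  have hrhs : (T₂ - T₁) / (2 * Real.Gamma (1 - α) * Real.Gamma (2 - α)) *
      (1 / (lam ^ 2 * T₁ ^ α * T₂ ^ α)) =
        (T₂ - T₁) * (g₁ * g₂) / 2 / (lam ^ 2 * T₁ ^ α * T₂ ^ α) := by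
    rw [hg₁, hg₂, mul_one_div]
    have := hG1.ne
    field_simp
  rw [hrhs]
  refine ⟨?_, div_neg_of_neg_of_pos ?_ hZ⟩
  · rw [le_div_iff₀ hZ]
    refine le_trans (le_of_eq ?_) key
    unfold psiDet
    ring
  · nlinarith [mul_neg_of_pos_of_neg (sub_pos.2 hT) hgg]
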